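/- arXiv:0912.4184 — 8 statements merged into one kernel-verified Lean document; each statement's English description precedes it below -/
import Mathlib

section
/- For every term e of the base language (containing no defined function symbols), every assignment α, and all memories m, m' : Ptr → Option Val: if ⟦𝔐(e)⟧_{m,α} = some S for some set S of pointers and m q = m' q for all q ∈ S, then ⟦e⟧_{m,α} = ⟦e⟧_{m',α} and ⟦𝔐(e)⟧_{m,α} = ⟦𝔐(e)⟧_{m',α}. -/
namespace ScopeLogic

/-- The type of values: integers, booleans, and pointers (`Ptr ⊆ Val`). -/
abbrev Val (Ptr : Type) : Type := ℤ ⊕ Bool ⊕ Ptr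

/-- The injection of pointers into values. -/
def Val.ptr {Ptr : Type} (p : Ptr) : Val Ptr := Sum.inr (Sum.inr p)

/-- The injection of booleans into values. -/
def Val.bool {Ptr : Type} (b : Bool) : Val Ptr := Sum.inr (Sum.inl b)

/-- Terms of the base language: variables, pure applications, memory reads,
and conditionals. `Var` is the type of variables, `F` the family of pure
function symbols, `ar f` the arity of `f`. -/
inductive Term (Var F : Type) (ar : F → ℕ) : Type where
  | var : Var → Term Var F ar
  | app : (f : F) → (Fin (ar f) → Term Var F ar) → Term Var F ar
  | read : Term Var F ar → Term Var F ar
  | cond : Term Var F ar → Term Var F ar → Term Var F ar → Term Var F ar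

variable {Ptr Var F : Type} {ar : F → ℕ}

/-- Partial evaluation `⟦e⟧_{m,α}` of a term in memory `m` under assignment `α`,
where `interp` gives the fixed memory-independent meaning of pure symbols. -/
def eval (interp : (f : F) → (Fin (ar f) → Val Ptr) → Option (Val Ptr))
    (m : Ptr → Option (Val Ptr)) (α : Var → Val Ptr) :
    Term Var F ar → Option (Val Ptr)
  | .var x => some (α x)
  | .app f es =>
      if h : ∀ i, (eval interp m α (es i)).isSome then
        interp f (fun i => (eval interp m α (es i)).get (h i))
      else none
  | .read e =>
      match eval interp m α e with
      | some (Sum.inr (Sum.inr q)) => m q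
      | _ => none
  | .cond e₀ e₁ e₂ =>
      match eval interp m α e₀ with
      | some (Sum.inr (Sum.inl true)) => eval interp m α e₁
      | some (Sum.inr (Sum.inl false)) => eval interp m α e₂
      | _ => none

/-- The memory scope `⟦𝔐(e)⟧_{m,α}` of a term: the set of memory units
accessed when evaluating `e`, if defined. -/
def scope (interp : (f : F) → (Fin (ar f) → Val Ptr) → Option (Val Ptr))
    (m : Ptr → Option (Val Ptr)) (α : Var → Val Ptr) :
    Term Var F ar → Option (Set Ptr)
  | .var _ => some ∅
  | .app _ es =>
      if h : ∀ i, (scope interp m α (es i)).isSome then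
        some (⋃ i, (scope interp m α (es i)).get (h i))
      else none
  | .read e =>
      match eval interp m α e, scope interp m α e with
      | some (Sum.inr (Sum.inr q)), some S => some (S ∪ {q})
      | _, _ => none
  | .cond e₀ e₁ e₂ =>
      match eval interp m α e₀ with
      | some (Sum.inr (Sum.inl true)) =>
          match scope interp m α e₀, scope interp m α e₁ with
          | some S₀, some S₁ => some (S₀ ∪ S₁)
          | _, _ => none
      | some (Sum.inr (Sum.inl false)) =>
          match scope interp m α e₀, scope interp m α e₂ with
          | some S₀, some S₂ => some (S₀ ∪ S₂)
          | _, _ => none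
      | _ => none

end ScopeLogic

open ScopeLogic

theorem term_scope_agreement {Ptr Var F : Type} {ar : F → ℕ}
    (interp : (f : F) → (Fin (ar f) → Val Ptr) → Option (Val Ptr))
    (e : Term Var F ar) (α : Var → Val Ptr)
    (m m' : Ptr → Option (Val Ptr)) (S : Set Ptr)
    (hS : scope interp m α e = some S)
    (hagree : ∀ q ∈ S, m q = m' q) :
    eval interp m α e = eval interp m' α e ∧
    scope interp m α e = scope interp m' α e := by
  induction e generalizing S with
  | var x => exact ⟨rfl, rfl⟩
  | app f es ih =>
    simp only [scope] at hS
    split_ifs at hS with h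
    obtain rfl := Option.some.inj hS
    have key : ∀ i, eval interp m α (es i) = eval interp m' α (es i) ∧
        scope interp m α (es i) = scope interp m' α (es i) := fun i =>
      ih i _ (Option.some_get (h i)).symm
        fun q hq => hagree q (Set.mem_iUnion.mpr ⟨i, hq⟩)
    constructor
    · simp only [eval, (key _).1]
    · simp only [scope, (key _).2]
  | read e ih =>
    simp only [scope] at hS
    split at hS
    · rename_i q T he hT
      obtain rfl := Option.some.inj hS
      obtain ⟨hev, hsc⟩ := ih T hT fun p hp => hagree p (Or.inl hp)
      constructor
      · simp only [eval, ← hev, he]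
        exact hagree q (Or.inr rfl)
      · simp only [scope, ← hev, ← hsc]
    · cases hS
  | cond e₀ e₁ e₂ ih₀ ih₁ ih₂ =>
    simp only [scope] at hS
    split at hS
    · rename_i he
      split at hS
      · rename_i S₀ S₁ h₀ h₁
        obtain rfl := Option.some.inj hS
        obtain ⟨hev₀, hsc₀⟩ := ih₀ S₀ h₀ fun p hp => hagree p (Or.inl hp)
        obtain ⟨hev₁, hsc₁⟩ := ih₁ S₁ h₁ fun p hp => hagree p (Or.inr hp)
        constructor
        · simp only [eval, ← hev₀, he, hev₁]
        · simp only [scope, ← hev₀, he, hsc₀, hsc₁]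
      · cases hS
    · rename_i he
      split at hS
      · rename_i S₀ S₂ h₀ h₂
        obtain rfl := Option.some.inj hS
        obtain ⟨hev₀, hsc₀⟩ := ih₀ S₀ h₀ fun p hp => hagree p (Or.inl hp)
        obtain ⟨hev₂, hsc₂⟩ := ih₂ S₂ h₂ fun p hp => hagree p (Or.inr hp)
        constructor
        · simp only [eval, ← hev₀, he, hev₂]
        · simp only [scope, ← hev₀, he, hsc₀, hsc₂]
      · cases hS
    · cases hS
end

section
/- For every term e of the extended language with non-recursively defined function symbols, every assignment α, and all memories m, m': if ⟦𝔐(e)⟧_{m,α} = some S for some set S of pointers and m q = m' q for all q ∈ S, then ⟦e⟧_{m,α} = ⟦e⟧_{m',α} and ⟦𝔐(e)⟧_{m,α} = ⟦𝔐(e)⟧_{m',α}. -/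
namespace ScopeLogic

/-- Terms of the extended language: variables, pure applications, memory reads,
conditionals, and applications of the defined function symbols `g₀,…,g_{N-1}`,
where `k i` is the arity of `gᵢ`. -/
inductive DTerm (Var F : Type) (ar : F → ℕ) (N : ℕ) (k : Fin N → ℕ) : Type where
  | var : Var → DTerm Var F ar N k
  | app : (f : F) → (Fin (ar f) → DTerm Var F ar N k) → DTerm Var F ar N k
  | read : DTerm Var F ar N k → DTerm Var F ar N k
  | cond : DTerm Var F ar N k → DTerm Var F ar N k → DTerm Var F ar N k →
      DTerm Var F ar N k
  | dapp : (i : Fin N) → (Fin (k i) → DTerm Var F ar N k) → DTerm Var F ar N k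

variable {Ptr F : Type} {ar : F → ℕ} {N : ℕ} {k : Fin N → ℕ}

/-- Evaluation of extended terms, parametric in the semantics `dEval` used for
applications of defined function symbols. -/
def evalAux (interp : (f : F) → (Fin (ar f) → Val Ptr) → Option (Val Ptr))
    (dEval : (i : Fin N) → (Fin (k i) → Val Ptr) → Option (Val Ptr))
    (m : Ptr → Option (Val Ptr)) {V : Type} (α : V → Val Ptr) :
    DTerm V F ar N k → Option (Val Ptr)
  | .var x => some (α x)
  | .app f es =>
      if h : ∀ j, (evalAux interp dEval m α (es j)).isSome then
        interp f (fun j => (evalAux interp dEval m α (es j)).get (h j))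
      else none
  | .read e =>
      match evalAux interp dEval m α e with
      | some (Sum.inr (Sum.inr q)) => m q
      | _ => none
  | .cond e₀ e₁ e₂ =>
      match evalAux interp dEval m α e₀ with
      | some (Sum.inr (Sum.inl true)) => evalAux interp dEval m α e₁
      | some (Sum.inr (Sum.inl false)) => evalAux interp dEval m α e₂
      | _ => none
  | .dapp i es =>
      if h : ∀ j, (evalAux interp dEval m α (es j)).isSome then
        dEval i (fun j => (evalAux interp dEval m α (es j)).get (h j))
      else none

/-- Memory scope of extended terms, parametric in the value semantics `dEval`
and the scope semantics `dScope` of defined function symbols. -/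
def scopeAux (interp : (f : F) → (Fin (ar f) → Val Ptr) → Option (Val Ptr))
    (dEval : (i : Fin N) → (Fin (k i) → Val Ptr) → Option (Val Ptr))
    (dScope : (i : Fin N) → (Fin (k i) → Val Ptr) → Option (Set Ptr))
    (m : Ptr → Option (Val Ptr)) {V : Type} (α : V → Val Ptr) :
    DTerm V F ar N k → Option (Set Ptr)
  | .var _ => some ∅
  | .app _ es =>
      if h : ∀ j, (scopeAux interp dEval dScope m α (es j)).isSome then
        some (⋃ j, (scopeAux interp dEval dScope m α (es j)).get (h j))
      else none
  | .read e =>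
      match evalAux interp dEval m α e, scopeAux interp dEval dScope m α e with
      | some (Sum.inr (Sum.inr q)), some S => some (S ∪ {q})
      | _, _ => none
  | .cond e₀ e₁ e₂ =>
      match evalAux interp dEval m α e₀ with
      | some (Sum.inr (Sum.inl true)) =>
          match scopeAux interp dEval dScope m α e₀,
              scopeAux interp dEval dScope m α e₁ with
          | some S₀, some S₁ => some (S₀ ∪ S₁)
          | _, _ => none
      | some (Sum.inr (Sum.inl false)) =>
          match scopeAux interp dEval dScope m α e₀,
              scopeAux interp dEval dScope m α e₂ with
          | some S₀, some S₂ => some (S₀ ∪ S₂)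
          | _, _ => none
      | _ => none
  | .dapp i es =>
      if h : (∀ j, (evalAux interp dEval m α (es j)).isSome) ∧
          (∀ j, (scopeAux interp dEval dScope m α (es j)).isSome) then
        match dScope i (fun j => (evalAux interp dEval m α (es j)).get (h.1 j)) with
        | some S =>
            some ((⋃ j, (scopeAux interp dEval dScope m α (es j)).get (h.2 j)) ∪ S)
        | none => none
      else none

end ScopeLogic

namespace ScopeLogic

variable {Ptr F : Type} {ar : F → ℕ} {N : ℕ} {k : Fin N → ℕ}

/-- All defined function symbols occurring in a term have index `< b`. -/
def defBelow {V : Type} (b : ℕ) : DTerm V F ar N k → Prop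
  | .var _ => True
  | .app _ es => ∀ j, defBelow b (es j)
  | .read e => defBelow b e
  | .cond e₀ e₁ e₂ => defBelow b e₀ ∧ defBelow b e₁ ∧ defBelow b e₂
  | .dapp i es => i.val < b ∧ ∀ j, defBelow b (es j)

/-- The (direct) semantics of the non-recursively defined symbols `gᵢ`:
`gᵢ` is interpreted by evaluating its body `B i` (a term in the variables
`Fin (k i)`), in which only symbols `gⱼ` with `j < i` may be used. -/
noncomputable def dEvalD (interp : (f : F) → (Fin (ar f) → Val Ptr) → Option (Val Ptr))
    (B : (i : Fin N) → DTerm (Fin (k i)) F ar N k)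
    (m : Ptr → Option (Val Ptr)) :
    (i : Fin N) → (Fin (k i) → Val Ptr) → Option (Val Ptr) :=
  fun i args =>
    evalAux interp
      (fun j args' => if _h : j.val < i.val then dEvalD interp B m j args' else none)
      m args (B i)
termination_by i => i.val

/-- The (direct) scope semantics of the non-recursively defined symbols. -/
noncomputable def dScopeD (interp : (f : F) → (Fin (ar f) → Val Ptr) → Option (Val Ptr))
    (B : (i : Fin N) → DTerm (Fin (k i)) F ar N k)
    (m : Ptr → Option (Val Ptr)) :
    (i : Fin N) → (Fin (k i) → Val Ptr) → Option (Set Ptr) :=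
  fun i args =>
    scopeAux interp (dEvalD interp B m)
      (fun j args' => if _h : j.val < i.val then dScopeD interp B m j args' else none)
      m args (B i)
termination_by i => i.val

/-- Evaluation `⟦e⟧_{m,α}` in the extended language. -/
noncomputable def evalD (interp : (f : F) → (Fin (ar f) → Val Ptr) → Option (Val Ptr))
    (B : (i : Fin N) → DTerm (Fin (k i)) F ar N k)
    (m : Ptr → Option (Val Ptr)) {V : Type} (α : V → Val Ptr)
    (e : DTerm V F ar N k) : Option (Val Ptr) :=
  evalAux interp (dEvalD interp B m) m α e

/-- Memory scope `⟦𝔐(e)⟧_{m,α}` in the extended language. -/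
noncomputable def scopeD (interp : (f : F) → (Fin (ar f) → Val Ptr) → Option (Val Ptr))
    (B : (i : Fin N) → DTerm (Fin (k i)) F ar N k)
    (m : Ptr → Option (Val Ptr)) {V : Type} (α : V → Val Ptr)
    (e : DTerm V F ar N k) : Option (Set Ptr) :=
  scopeAux interp (dEvalD interp B m) (dScopeD interp B m) m α e

end ScopeLogic

open ScopeLogic

namespace ScopeLogic

variable {Ptr F : Type} {ar : F → ℕ} {N : ℕ} {k : Fin N → ℕ}

/-- Every defined symbol has index below `N`. -/
theorem defBelow_card {V : Type} (e : DTerm V F ar N k) : defBelow N e := by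
  induction e with
  | var x => trivial
  | app f es ih => exact ih
  | read e ih => exact ih
  | cond e₀ e₁ e₂ ih₀ ih₁ ih₂ => exact ⟨ih₀, ih₁, ih₂⟩
  | dapp i es ih => exact ⟨i.isLt, ih⟩

/-- The value of a term depends only on the semantics of the symbols it may use. -/
theorem evalAux_congr {interp : (f : F) → (Fin (ar f) → Val Ptr) → Option (Val Ptr)}
    {dEval dEval' : (i : Fin N) → (Fin (k i) → Val Ptr) → Option (Val Ptr)}
    {m : Ptr → Option (Val Ptr)} {V : Type} {α : V → Val Ptr} {b : ℕ}
    (hd : ∀ i : Fin N, i.val < b → dEval i = dEval' i)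
    (e : DTerm V F ar N k) (he : defBelow b e) :
    evalAux interp dEval m α e = evalAux interp dEval' m α e := by
  induction e with
  | var x => rfl
  | app f es ih =>
    have ih' := fun j => ih j (he j)
    simp only [evalAux, ih']
  | read e ih => simp only [evalAux, ih he]
  | cond e₀ e₁ e₂ ih₀ ih₁ ih₂ =>
    simp only [evalAux, ih₀ he.1, ih₁ he.2.1, ih₂ he.2.2]
  | dapp i es ih =>
    have ih' := fun j => ih j (he.2 j)
    simp only [evalAux, ih', hd i he.1]

/-- The scope of a term depends only on the scope semantics of the symbols it may use. -/
theorem scopeAux_congr {interp : (f : F) → (Fin (ar f) → Val Ptr) → Option (Val Ptr)}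
    {dEval : (i : Fin N) → (Fin (k i) → Val Ptr) → Option (Val Ptr)}
    {dScope dScope' : (i : Fin N) → (Fin (k i) → Val Ptr) → Option (Set Ptr)}
    {m : Ptr → Option (Val Ptr)} {V : Type} {α : V → Val Ptr} {b : ℕ}
    (hd : ∀ i : Fin N, i.val < b → dScope i = dScope' i)
    (e : DTerm V F ar N k) (he : defBelow b e) :
    scopeAux interp dEval dScope m α e = scopeAux interp dEval dScope' m α e := by
  induction e with
  | var x => rfl
  | app f es ih =>
    have ih' := fun j => ih j (he j)
    simp only [scopeAux, ih']
  | read e ih => simp only [scopeAux, ih he]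
  | cond e₀ e₁ e₂ ih₀ ih₁ ih₂ =>
    simp only [scopeAux, ih₀ he.1, ih₁ he.2.1, ih₂ he.2.2]
  | dapp i es ih =>
    have ih' := fun j => ih j (he.2 j)
    simp only [scopeAux, ih', hd i he.1]

theorem dEvalD_eq_evalD (interp : (f : F) → (Fin (ar f) → Val Ptr) → Option (Val Ptr))
    (B : (i : Fin N) → DTerm (Fin (k i)) F ar N k) (m : Ptr → Option (Val Ptr))
    {i : Fin N} (hB : defBelow i.val (B i)) (args : Fin (k i) → Val Ptr) :
    dEvalD interp B m i args = evalD interp B m args (B i) := by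
  rw [dEvalD]
  exact evalAux_congr (fun j hj => by simp [hj]) _ hB

theorem dScopeD_eq_scopeD (interp : (f : F) → (Fin (ar f) → Val Ptr) → Option (Val Ptr))
    (B : (i : Fin N) → DTerm (Fin (k i)) F ar N k) (m : Ptr → Option (Val Ptr))
    {i : Fin N} (hB : defBelow i.val (B i)) (args : Fin (k i) → Val Ptr) :
    dScopeD interp B m i args = scopeD interp B m args (B i) := by
  rw [dScopeD]
  exact scopeAux_congr (fun j hj => by simp [hj]) _ hB

/-- If the semantics of the symbols of index below `b` is determined by the memory on
their scope, then so is the semantics of every term using only those symbols. -/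
theorem scopeAux_agreement
    {interp : (f : F) → (Fin (ar f) → Val Ptr) → Option (Val Ptr)}
    {dEval dEval' : (i : Fin N) → (Fin (k i) → Val Ptr) → Option (Val Ptr)}
    {dScope dScope' : (i : Fin N) → (Fin (k i) → Val Ptr) → Option (Set Ptr)}
    {m m' : Ptr → Option (Val Ptr)} {V : Type} {α : V → Val Ptr} {b : ℕ}
    (hd : ∀ i : Fin N, i.val < b → ∀ args S, dScope i args = some S →
      (∀ q ∈ S, m q = m' q) →
      dEval i args = dEval' i args ∧ dScope i args = dScope' i args)
    (e : DTerm V F ar N k) (he : defBelow b e) {S : Set Ptr}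
    (hS : scopeAux interp dEval dScope m α e = some S) (hm : ∀ q ∈ S, m q = m' q) :
    evalAux interp dEval m α e = evalAux interp dEval' m' α e ∧
      scopeAux interp dEval dScope m α e = scopeAux interp dEval' dScope' m' α e := by
  induction e generalizing S with
  | var x => exact ⟨rfl, rfl⟩
  | app f es ih =>
    simp only [scopeAux] at hS
    split_ifs at hS with h
    obtain rfl := Option.some.inj hS
    have ih' := fun j => ih j (he j) (Option.some_get (h j)).symm
      fun q hq => hm q (Set.mem_iUnion.2 ⟨j, hq⟩)
    simp only [evalAux, scopeAux, fun j => (ih' j).1, fun j => (ih' j).2, and_self]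
  | read e ih =>
    simp only [scopeAux] at hS
    split at hS
    · rename_i q T hq hT
      obtain rfl := Option.some.inj hS
      obtain ⟨h₁, h₂⟩ := ih he hT fun q hq => hm q (Or.inl hq)
      simp only [evalAux, scopeAux, ← h₁, ← h₂, hq, hm q (Or.inr rfl), and_self]
    · cases hS
  | cond e₀ e₁ e₂ ih₀ ih₁ ih₂ =>
    simp only [scopeAux] at hS
    split at hS
    · rename_i hv
      split at hS
      · rename_i S₀ S₁ hS₀ hS₁
        obtain rfl := Option.some.inj hS
        obtain ⟨h₁, h₂⟩ := ih₀ he.1 hS₀ fun q hq => hm q (Or.inl hq)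
        obtain ⟨h₃, h₄⟩ := ih₁ he.2.1 hS₁ fun q hq => hm q (Or.inr hq)
        simp only [evalAux, scopeAux, ← h₁, ← h₂, hv, h₃, h₄, and_self]
      · cases hS
    · rename_i hv
      split at hS
      · rename_i S₀ S₂ hS₀ hS₂
        obtain rfl := Option.some.inj hS
        obtain ⟨h₁, h₂⟩ := ih₀ he.1 hS₀ fun q hq => hm q (Or.inl hq)
        obtain ⟨h₃, h₄⟩ := ih₂ he.2.2 hS₂ fun q hq => hm q (Or.inr hq)
        simp only [evalAux, scopeAux, ← h₁, ← h₂, hv, h₃, h₄, and_self]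
      · cases hS
    · cases hS
  | dapp i es ih =>
    simp only [scopeAux] at hS
    split_ifs at hS with h
    split at hS
    · rename_i T hT
      obtain rfl := Option.some.inj hS
      have ih' := fun j => ih j (he.2 j) (Option.some_get (h.2 j)).symm
        fun q hq => hm q (Or.inl (Set.mem_iUnion.2 ⟨j, hq⟩))
      obtain ⟨h₁, h₂⟩ := hd i he.1 _ T hT fun q hq => hm q (Or.inr hq)
      simp only [fun j => (ih' j).1] at h₁ h₂
      simp only [evalAux, scopeAux, fun j => (ih' j).1, fun j => (ih' j).2, h₁, h₂,
        and_self]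
    · cases hS

/-- The semantics of a defined symbol is determined by the memory on its scope. -/
theorem dScopeD_agreement (interp : (f : F) → (Fin (ar f) → Val Ptr) → Option (Val Ptr))
    (B : (i : Fin N) → DTerm (Fin (k i)) F ar N k)
    (hB : ∀ i : Fin N, defBelow i.val (B i)) (m m' : Ptr → Option (Val Ptr))
    (i : Fin N) (args : Fin (k i) → Val Ptr) (S : Set Ptr)
    (hS : dScopeD interp B m i args = some S) (hm : ∀ q ∈ S, m q = m' q) :
    dEvalD interp B m i args = dEvalD interp B m' i args ∧
      dScopeD interp B m i args = dScopeD interp B m' i args := by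
  simp only [dEvalD_eq_evalD interp B _ (hB i), dScopeD_eq_scopeD interp B _ (hB i)] at hS ⊢
  exact scopeAux_agreement
    (fun j _ args' T hT hT' => dScopeD_agreement interp B hB m m' j args' T hT hT')
    (B i) (hB i) hS hm
termination_by i.val

end ScopeLogic

theorem extended_term_scope_agreement {Ptr Var F : Type} {ar : F → ℕ}
    {N : ℕ} {k : Fin N → ℕ}
    (interp : (f : F) → (Fin (ar f) → Val Ptr) → Option (Val Ptr))
    (B : (i : Fin N) → DTerm (Fin (k i)) F ar N k)
    (hB : ∀ i : Fin N, defBelow i.val (B i))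
    (e : DTerm Var F ar N k) (α : Var → Val Ptr)
    (m m' : Ptr → Option (Val Ptr)) (S : Set Ptr)
    (hS : scopeD interp B m α e = some S)
    (hagree : ∀ q ∈ S, m q = m' q) :
    evalD interp B m α e = evalD interp B m' α e ∧
    scopeD interp B m α e = scopeD interp B m' α e := by
  exact scopeAux_agreement
    (fun i _ => dScopeD_agreement interp B hB m m' i) e (defBelow_card e) hS hagree
end

section
/- (Lemma 1) For every term e of the extended language with (possibly mutually) recursively defined function symbols, every assignment α, and all memories m, m': if ⟦𝔐(e)⟧_{m,α} = some S for some set S of pointers and m q = m' q for all q ∈ S, then ⟦e⟧_{m,α} = ⟦e⟧_{m',α} and ⟦𝔐(e)⟧_{m,α} = ⟦𝔐(e)⟧_{m',α}. -/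
namespace ScopeLogic

variable {Ptr F : Type} {ar : F → ℕ} {N : ℕ} {k : Fin N → ℕ}

/-- A term contains no defined function symbol. -/
def pureTerm {V : Type} : DTerm V F ar N k → Prop
  | .var _ => True
  | .app _ es => ∀ j, pureTerm (es j)
  | .read e => pureTerm e
  | .cond e₀ e₁ e₂ => pureTerm e₀ ∧ pureTerm e₁ ∧ pureTerm e₂
  | .dapp _ _ => False

/-- In every conditional subterm `e₀ ? e₁ : e₂`, the guard `e₀` contains no
defined function symbol. -/
def guardsPure {V : Type} : DTerm V F ar N k → Prop
  | .var _ => True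
  | .app _ es => ∀ j, guardsPure (es j)
  | .read e => guardsPure e
  | .cond e₀ e₁ e₂ => pureTerm e₀ ∧ guardsPure e₁ ∧ guardsPure e₂
  | .dapp _ es => ∀ j, guardsPure (es j)

/-- Fuel-indexed approximations of the semantics of the (possibly mutually
recursively) defined symbols: with zero fuel every application of a defined
symbol is undefined; with fuel `n+1`, `gᵢ` is interpreted by evaluating its
body `B i` with fuel `n`. -/
def dEvalF (interp : (f : F) → (Fin (ar f) → Val Ptr) → Option (Val Ptr))
    (B : (i : Fin N) → DTerm (Fin (k i)) F ar N k)
    (m : Ptr → Option (Val Ptr)) :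
    ℕ → (i : Fin N) → (Fin (k i) → Val Ptr) → Option (Val Ptr)
  | 0 => fun _ _ => none
  | n + 1 => fun i args => evalAux interp (dEvalF interp B m n) m args (B i)

/-- Fuel-indexed approximations of the scope semantics of defined symbols. -/
def dScopeF (interp : (f : F) → (Fin (ar f) → Val Ptr) → Option (Val Ptr))
    (B : (i : Fin N) → DTerm (Fin (k i)) F ar N k)
    (m : Ptr → Option (Val Ptr)) :
    ℕ → (i : Fin N) → (Fin (k i) → Val Ptr) → Option (Set Ptr)
  | 0 => fun _ _ => none
  | n + 1 => fun i args =>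
      scopeAux interp (dEvalF interp B m n) (dScopeF interp B m n) m args (B i)

/-- The `n`-th fuel approximation `evalₙ(e)_{m,α}` of the value of a term. -/
def evalF (interp : (f : F) → (Fin (ar f) → Val Ptr) → Option (Val Ptr))
    (B : (i : Fin N) → DTerm (Fin (k i)) F ar N k)
    (m : Ptr → Option (Val Ptr)) (n : ℕ) {V : Type} (α : V → Val Ptr)
    (e : DTerm V F ar N k) : Option (Val Ptr) :=
  evalAux interp (dEvalF interp B m n) m α e

/-- The `n`-th fuel approximation `scopeₙ(e)_{m,α}` of the memory scope of a term. -/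
def scopeF (interp : (f : F) → (Fin (ar f) → Val Ptr) → Option (Val Ptr))
    (B : (i : Fin N) → DTerm (Fin (k i)) F ar N k)
    (m : Ptr → Option (Val Ptr)) (n : ℕ) {V : Type} (α : V → Val Ptr)
    (e : DTerm V F ar N k) : Option (Set Ptr) :=
  scopeAux interp (dEvalF interp B m n) (dScopeF interp B m n) m α e

end ScopeLogic

open ScopeLogic

namespace ScopeLogic

variable {Ptr F V : Type} {ar : F → ℕ} {N : ℕ} {k : Fin N → ℕ}
  {interp : (f : F) → (Fin (ar f) → Val Ptr) → Option (Val Ptr)}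
  {dEval dEval' : (i : Fin N) → (Fin (k i) → Val Ptr) → Option (Val Ptr)}
  {dScope dScope' : (i : Fin N) → (Fin (k i) → Val Ptr) → Option (Set Ptr)}
  {m m' : Ptr → Option (Val Ptr)} {α : V → Val Ptr}

theorem dite_isSome_eq_some_iff {ι A C : Type} (E : ι → Option A) (G : (ι → A) → Option C)
    (c : C) [Decidable (∀ j, (E j).isSome)] :
    (if h : ∀ j, (E j).isSome then G (fun j => (E j).get (h j)) else none) = some c ↔
      ∃ vs : ι → A, (∀ j, E j = some (vs j)) ∧ G vs = some c := by
  constructor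
  · intro h
    split_ifs at h with h'
    exact ⟨_, fun j => (Option.some_get (h' j)).symm, h⟩
  · rintro ⟨vs, hvs, hG⟩
    obtain rfl : E = fun j => some (vs j) := funext hvs
    simpa using hG

theorem evalAux_app_eq_some_iff {f : F} {es : Fin (ar f) → DTerm V F ar N k} {v : Val Ptr} :
    evalAux interp dEval m α (.app f es) = some v ↔
      ∃ vs, (∀ j, evalAux interp dEval m α (es j) = some (vs j)) ∧ interp f vs = some v := by
  rw [evalAux]
  exact dite_isSome_eq_some_iff _ (interp f) v

theorem evalAux_dapp_eq_some_iff {i : Fin N} {es : Fin (k i) → DTerm V F ar N k} {v : Val Ptr} :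
    evalAux interp dEval m α (.dapp i es) = some v ↔
      ∃ vs, (∀ j, evalAux interp dEval m α (es j) = some (vs j)) ∧ dEval i vs = some v := by
  rw [evalAux]
  exact dite_isSome_eq_some_iff _ (dEval i) v

theorem evalAux_read_eq_some_iff {e : DTerm V F ar N k} {v : Val Ptr} :
    evalAux interp dEval m α (.read e) = some v ↔
      ∃ q, evalAux interp dEval m α e = some (.inr (.inr q)) ∧ m q = some v := by
  rw [evalAux]
  rcases evalAux interp dEval m α e with _ | _ | _ | _ <;> simp

theorem evalAux_cond_eq_some_iff {e₀ e₁ e₂ : DTerm V F ar N k} {v : Val Ptr} :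
    evalAux interp dEval m α (.cond e₀ e₁ e₂) = some v ↔
      ∃ b : Bool, evalAux interp dEval m α e₀ = some (.inr (.inl b)) ∧
        evalAux interp dEval m α (if b then e₁ else e₂) = some v := by
  rw [evalAux]
  rcases evalAux interp dEval m α e₀ with _ | _ | (_ | _) | _ <;> simp

theorem scopeAux_app_eq_some_iff {f : F} {es : Fin (ar f) → DTerm V F ar N k} {S : Set Ptr} :
    scopeAux interp dEval dScope m α (.app f es) = some S ↔
      ∃ Ss : Fin (ar f) → Set Ptr,
        (∀ j, scopeAux interp dEval dScope m α (es j) = some (Ss j)) ∧ ⋃ j, Ss j = S := by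
  rw [scopeAux]
  refine (dite_isSome_eq_some_iff _ (fun Ss => some (⋃ j, Ss j)) S).trans ?_
  simp only [Option.some.injEq]

theorem scopeAux_read_eq_some_iff {e : DTerm V F ar N k} {S : Set Ptr} :
    scopeAux interp dEval dScope m α (.read e) = some S ↔
      ∃ q T, evalAux interp dEval m α e = some (.inr (.inr q)) ∧
        scopeAux interp dEval dScope m α e = some T ∧ T ∪ {q} = S := by
  rw [scopeAux]
  rcases evalAux interp dEval m α e with _ | _ | _ | _ <;>
    rcases scopeAux interp dEval dScope m α e with _ | _ <;> simp

theorem scopeAux_cond_eq_some_iff {e₀ e₁ e₂ : DTerm V F ar N k} {S : Set Ptr} :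
    scopeAux interp dEval dScope m α (.cond e₀ e₁ e₂) = some S ↔
      ∃ (b : Bool) (S₀ T : Set Ptr), evalAux interp dEval m α e₀ = some (.inr (.inl b)) ∧
        scopeAux interp dEval dScope m α e₀ = some S₀ ∧
        scopeAux interp dEval dScope m α (if b then e₁ else e₂) = some T ∧ S₀ ∪ T = S := by
  rw [scopeAux]
  rcases evalAux interp dEval m α e₀ with _ | _ | (_ | _) | _ <;>
    rcases scopeAux interp dEval dScope m α e₀ with _ | _ <;>
    rcases h₁ : scopeAux interp dEval dScope m α e₁ with _ | _ <;>
    rcases h₂ : scopeAux interp dEval dScope m α e₂ with _ | _ <;> simp [h₁, h₂]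

theorem scopeAux_dapp_eq_some_iff {i : Fin N} {es : Fin (k i) → DTerm V F ar N k}
    {S : Set Ptr} :
    scopeAux interp dEval dScope m α (.dapp i es) = some S ↔
      ∃ (vs : Fin (k i) → Val Ptr) (Ss : Fin (k i) → Set Ptr) (T : Set Ptr),
        (∀ j, evalAux interp dEval m α (es j) = some (vs j)) ∧
        (∀ j, scopeAux interp dEval dScope m α (es j) = some (Ss j)) ∧
        dScope i vs = some T ∧ (⋃ j, Ss j) ∪ T = S := by
  rw [scopeAux]
  constructor
  · intro h
    split_ifs at h with h'
    split at h
    · rename_i T hT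
      exact ⟨_, _, T, fun j => (Option.some_get (h'.1 j)).symm,
        fun j => (Option.some_get (h'.2 j)).symm, hT, Option.some.inj h⟩
    · cases h
  · rintro ⟨vs, Ss, T, hvs, hSs, hT, rfl⟩
    simp [hvs, hSs, hT]

theorem evalAux_mono (hd : ∀ i a v, dEval i a = some v → dEval' i a = some v)
    (e : DTerm V F ar N k) {v : Val Ptr} (h : evalAux interp dEval m α e = some v) :
    evalAux interp dEval' m α e = some v := by
  induction e generalizing v with
  | var x => simpa only [evalAux] using h
  | app f es ih =>
    obtain ⟨vs, hvs, hv⟩ := evalAux_app_eq_some_iff.1 h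
    exact evalAux_app_eq_some_iff.2 ⟨vs, fun j => ih j (hvs j), hv⟩
  | read e ih =>
    obtain ⟨q, hq, hv⟩ := evalAux_read_eq_some_iff.1 h
    exact evalAux_read_eq_some_iff.2 ⟨q, ih hq, hv⟩
  | cond e₀ e₁ e₂ ih₀ ih₁ ih₂ =>
    obtain ⟨b, hb, hv⟩ := evalAux_cond_eq_some_iff.1 h
    refine evalAux_cond_eq_some_iff.2 ⟨b, ih₀ hb, ?_⟩
    cases b
    · exact ih₂ hv
    · exact ih₁ hv
  | dapp i es ih =>
    obtain ⟨vs, hvs, hv⟩ := evalAux_dapp_eq_some_iff.1 h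
    exact evalAux_dapp_eq_some_iff.2 ⟨vs, fun j => ih j (hvs j), hd _ _ _ hv⟩

theorem scopeAux_mono (hd : ∀ i a v, dEval i a = some v → dEval' i a = some v)
    (hs : ∀ i a S, dScope i a = some S → dScope' i a = some S)
    (e : DTerm V F ar N k) {S : Set Ptr} (h : scopeAux interp dEval dScope m α e = some S) :
    scopeAux interp dEval' dScope' m α e = some S := by
  induction e generalizing S with
  | var x => simpa only [scopeAux] using h
  | app f es ih =>
    obtain ⟨Ss, hSs, hS⟩ := scopeAux_app_eq_some_iff.1 h
    exact scopeAux_app_eq_some_iff.2 ⟨Ss, fun j => ih j (hSs j), hS⟩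
  | read e ih =>
    obtain ⟨q, T, hq, hT, hS⟩ := scopeAux_read_eq_some_iff.1 h
    exact scopeAux_read_eq_some_iff.2 ⟨q, T, evalAux_mono hd e hq, ih hT, hS⟩
  | cond e₀ e₁ e₂ ih₀ ih₁ ih₂ =>
    obtain ⟨b, S₀, T, hb, hS₀, hT, hS⟩ := scopeAux_cond_eq_some_iff.1 h
    refine scopeAux_cond_eq_some_iff.2 ⟨b, S₀, T, evalAux_mono hd e₀ hb, ih₀ hS₀, ?_, hS⟩
    cases b
    · exact ih₂ hT
    · exact ih₁ hT
  | dapp i es ih =>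
    obtain ⟨vs, Ss, T, hvs, hSs, hT, hS⟩ := scopeAux_dapp_eq_some_iff.1 h
    exact scopeAux_dapp_eq_some_iff.2 ⟨vs, Ss, T, fun j => evalAux_mono hd (es j) (hvs j),
      fun j => ih j (hSs j), hs _ _ _ hT, hS⟩

/-- If the semantics of the defined symbols in two memories agree whenever the memories agree
on their scope, then the same holds for all terms. -/
theorem evalAux_eq_and_scopeAux_eq_of_agree
    (hd : ∀ i a S, dScope i a = some S → (∀ q ∈ S, m q = m' q) →
      dEval i a = dEval' i a ∧ dScope' i a = some S)
    (e : DTerm V F ar N k) {S : Set Ptr} (h : scopeAux interp dEval dScope m α e = some S)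
    (hagree : ∀ q ∈ S, m q = m' q) :
    evalAux interp dEval m α e = evalAux interp dEval' m' α e ∧
      scopeAux interp dEval' dScope' m' α e = some S := by
  induction e generalizing S with
  | var x => exact ⟨by simp only [evalAux], by simpa only [scopeAux] using h⟩
  | app f es ih =>
    obtain ⟨Ss, hSs, rfl⟩ := scopeAux_app_eq_some_iff.1 h
    have hj := fun j => ih j (hSs j) fun q hq => hagree q (Set.mem_iUnion_of_mem j hq)
    refine ⟨Option.ext fun v => ?_, scopeAux_app_eq_some_iff.2 ⟨Ss, fun j => (hj j).2, rfl⟩⟩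
    simp only [evalAux_app_eq_some_iff, (hj _).1]
  | read e ih =>
    obtain ⟨q, T, hq, hT, rfl⟩ := scopeAux_read_eq_some_iff.1 h
    obtain ⟨he, hs⟩ := ih hT fun q hq => hagree q (Or.inl hq)
    have hq' := he.symm.trans hq
    refine ⟨?_, scopeAux_read_eq_some_iff.2 ⟨q, T, hq', hs, rfl⟩⟩
    simp only [evalAux, hq, hq']
    exact hagree q (Or.inr rfl)
  | cond e₀ e₁ e₂ ih₀ ih₁ ih₂ =>
    obtain ⟨b, S₀, T, hb, hS₀, hT, rfl⟩ := scopeAux_cond_eq_some_iff.1 h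
    obtain ⟨he₀, hs₀⟩ := ih₀ hS₀ fun q hq => hagree q (Or.inl hq)
    have hb' := he₀.symm.trans hb
    have hbranch : evalAux interp dEval m α (if b then e₁ else e₂) =
          evalAux interp dEval' m' α (if b then e₁ else e₂) ∧
        scopeAux interp dEval' dScope' m' α (if b then e₁ else e₂) = some T := by
      cases b
      · exact ih₂ hT fun q hq => hagree q (Or.inr hq)
      · exact ih₁ hT fun q hq => hagree q (Or.inr hq)
    refine ⟨Option.ext fun v => ?_,
      scopeAux_cond_eq_some_iff.2 ⟨b, S₀, T, hb', hs₀, hbranch.2, rfl⟩⟩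
    simp only [evalAux_cond_eq_some_iff, hb, hb', Option.some.injEq, Sum.inr.injEq,
      Sum.inl.injEq, exists_eq_left', hbranch.1]
  | dapp i es ih =>
    obtain ⟨vs, Ss, T, hvs, hSs, hT, rfl⟩ := scopeAux_dapp_eq_some_iff.1 h
    have hj := fun j => ih j (hSs j) fun q hq => hagree q (Or.inl (Set.mem_iUnion_of_mem j hq))
    have hvs' := fun j => (hj j).1.symm.trans (hvs j)
    obtain ⟨hde, hds⟩ := hd i vs T hT fun q hq => hagree q (Or.inr hq)
    refine ⟨?_, scopeAux_dapp_eq_some_iff.2 ⟨vs, Ss, T, hvs', fun j => (hj j).2, hds, rfl⟩⟩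
    simp [evalAux, hvs, hvs', hde]

variable {B : (i : Fin N) → DTerm (Fin (k i)) F ar N k} {n n' : ℕ}

theorem dEvalF_mono (hn : n ≤ n') (i : Fin N) (a : Fin (k i) → Val Ptr) (v : Val Ptr)
    (h : dEvalF interp B m n i a = some v) : dEvalF interp B m n' i a = some v := by
  induction n generalizing n' i a v with
  | zero => simp [dEvalF] at h
  | succ n ih =>
    obtain ⟨n', rfl⟩ := Nat.exists_eq_add_one_of_ne_zero (show n' ≠ 0 by omega)
    rw [dEvalF] at h ⊢
    exact evalAux_mono (ih (by omega)) (B i) h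

theorem dScopeF_mono (hn : n ≤ n') (i : Fin N) (a : Fin (k i) → Val Ptr) (S : Set Ptr)
    (h : dScopeF interp B m n i a = some S) : dScopeF interp B m n' i a = some S := by
  induction n generalizing n' i a S with
  | zero => simp [dScopeF] at h
  | succ n ih =>
    obtain ⟨n', rfl⟩ := Nat.exists_eq_add_one_of_ne_zero (show n' ≠ 0 by omega)
    rw [dScopeF] at h ⊢
    exact scopeAux_mono (dEvalF_mono (by omega)) (ih (by omega)) (B i) h

theorem evalF_mono (hn : n ≤ n') {e : DTerm V F ar N k} {v : Val Ptr}
    (h : evalF interp B m n α e = some v) : evalF interp B m n' α e = some v :=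
  evalAux_mono (dEvalF_mono hn) e h

theorem scopeF_mono (hn : n ≤ n') {e : DTerm V F ar N k} {S : Set Ptr}
    (h : scopeF interp B m n α e = some S) : scopeF interp B m n' α e = some S :=
  scopeAux_mono (dEvalF_mono hn) (dScopeF_mono hn) e h

theorem scopeF_unique {e : DTerm V F ar N k} {S S' : Set Ptr}
    (h : scopeF interp B m n α e = some S) (h' : scopeF interp B m n' α e = some S') :
    S = S' :=
  Option.some.inj ((scopeF_mono (le_max_left n n') h).symm.trans
    (scopeF_mono (le_max_right n n') h'))

theorem dEvalF_eq_and_dScopeF_eq_of_agree (i : Fin N) (a : Fin (k i) → Val Ptr) (S : Set Ptr)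
    (h : dScopeF interp B m n i a = some S) (hagree : ∀ q ∈ S, m q = m' q) :
    dEvalF interp B m n i a = dEvalF interp B m' n i a ∧
      dScopeF interp B m' n i a = some S := by
  induction n generalizing i a S with
  | zero => simp [dScopeF] at h
  | succ n ih =>
    simp only [dScopeF, dEvalF] at h ⊢
    exact evalAux_eq_and_scopeAux_eq_of_agree ih (B i) h hagree

theorem evalF_eq_and_scopeF_eq_of_agree {e : DTerm V F ar N k} {S : Set Ptr}
    (h : scopeF interp B m n α e = some S) (hagree : ∀ q ∈ S, m q = m' q) :
    evalF interp B m n α e = evalF interp B m' n α e ∧ scopeF interp B m' n α e = some S :=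
  evalAux_eq_and_scopeAux_eq_of_agree dEvalF_eq_and_dScopeF_eq_of_agree e h hagree

end ScopeLogic

theorem recursive_term_scope_agreement {Ptr Var F : Type} {ar : F → ℕ}
    {N : ℕ} {k : Fin N → ℕ}
    (interp : (f : F) → (Fin (ar f) → Val Ptr) → Option (Val Ptr))
    (B : (i : Fin N) → DTerm (Fin (k i)) F ar N k)
    (hB : ∀ i : Fin N, guardsPure (B i))
    (e : DTerm Var F ar N k) (α : Var → Val Ptr)
    (m m' : Ptr → Option (Val Ptr)) (S : Set Ptr)
    (hS : ∃ n : ℕ, scopeF interp B m n α e = some S)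
    (hagree : ∀ q ∈ S, m q = m' q) :
    (∀ v : Val Ptr,
      (∃ n : ℕ, evalF interp B m n α e = some v) ↔
      (∃ n : ℕ, evalF interp B m' n α e = some v)) ∧
    (∀ S' : Set Ptr,
      (∃ n : ℕ, scopeF interp B m n α e = some S') ↔
      (∃ n : ℕ, scopeF interp B m' n α e = some S')) := by
  obtain ⟨n₀, h₀⟩ := hS
  have hev : ∀ n, evalF interp B m (max n n₀) α e = evalF interp B m' (max n n₀) α e :=
    fun n => (evalF_eq_and_scopeF_eq_of_agree (scopeF_mono (le_max_right n n₀) h₀) hagree).1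
  have h₀' := (evalF_eq_and_scopeF_eq_of_agree h₀ hagree).2
  refine ⟨fun v => ⟨?_, ?_⟩, fun S' => ⟨?_, ?_⟩⟩
  · rintro ⟨n, hn⟩
    exact ⟨max n n₀, (hev n).symm.trans (evalF_mono (le_max_left n n₀) hn)⟩
  · rintro ⟨n, hn⟩
    exact ⟨max n n₀, (hev n).trans (evalF_mono (le_max_left n n₀) hn)⟩
  · rintro ⟨n, hn⟩
    exact ⟨n₀, scopeF_unique h₀ hn ▸ h₀'⟩
  · rintro ⟨n, hn⟩
    exact ⟨n₀, scopeF_unique h₀' hn ▸ h₀⟩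
end

section
/- (Theorem 1) Let p be a formula and m, m' be memories such that for every top-level term e of p and every assignment α', ⟦𝔐(e)⟧_{m,α'} = some S_{e,α'} for some set S_{e,α'} of pointers and m q = m' q for all q ∈ S_{e,α'}. Then ⟦p⟧_{m,α} = ⟦p⟧_{m',α} for every assignment α. -/
namespace ScopeLogic

/-- LPF formulas over terms: equalities, boolean atomic terms, negation,
conjunction, the definedness operator `Δ`, and universal quantification. -/
inductive Formula (Var F : Type) (ar : F → ℕ) : Type where
  | eq : Term Var F ar → Term Var F ar → Formula Var F ar
  | atom : Term Var F ar → Formula Var F ar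
  | not : Formula Var F ar → Formula Var F ar
  | and : Formula Var F ar → Formula Var F ar → Formula Var F ar
  | delta : Formula Var F ar → Formula Var F ar
  | all : Var → Formula Var F ar → Formula Var F ar

variable {Ptr Var F : Type} {ar : F → ℕ}

open Classical in
/-- Updating an assignment at one variable. -/
noncomputable def upd (α : Var → Val Ptr) (x : Var) (v : Val Ptr) : Var → Val Ptr :=
  fun y => if y = x then v else α y

open Classical in
/-- Three-valued LPF semantics of formulas, `none` being the undefined
truth value `⊛`. -/
noncomputable def feval (interp : (f : F) → (Fin (ar f) → Val Ptr) → Option (Val Ptr))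
    (m : Ptr → Option (Val Ptr)) (α : Var → Val Ptr) :
    Formula Var F ar → Option Bool
  | .eq e₁ e₂ =>
      match eval interp m α e₁, eval interp m α e₂ with
      | some v₁, some v₂ => if v₁ = v₂ then some true else some false
      | _, _ => none
  | .atom e =>
      match eval interp m α e with
      | some (Sum.inr (Sum.inl b)) => some b
      | _ => none
  | .not p => (feval interp m α p).map (fun b => !b)
  | .and p q =>
      match feval interp m α p, feval interp m α q with
      | some false, _ => some false
      | _, some false => some false
      | some true, some true => some true
      | _, _ => none
  | .delta p => some (feval interp m α p).isSome
  | .all x p =>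
      if ∃ v : Val Ptr, feval interp m (upd α x v) p = some false then some false
      else if ∀ v : Val Ptr, feval interp m (upd α x v) p = some true then some true
      else none

/-- The top-level (maximal) terms occurring in a formula. -/
def TopTerms : Formula Var F ar → Set (Term Var F ar)
  | .eq e₁ e₂ => {e₁, e₂}
  | .atom e => {e}
  | .not p => TopTerms p
  | .and p q => TopTerms p ∪ TopTerms q
  | .delta p => TopTerms p
  | .all _ p => TopTerms p

end ScopeLogic

namespace ScopeLogic

/-- A term evaluates identically in two memories that agree on its scope. -/
theorem eval_eq_of_scope_agree {Ptr Var F : Type} {ar : F → ℕ}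
    (interp : (f : F) → (Fin (ar f) → Val Ptr) → Option (Val Ptr))
    (m m' : Ptr → Option (Val Ptr)) (α : Var → Val Ptr) (e : Term Var F ar) {S : Set Ptr}
    (hS : scope interp m α e = some S) (hm : ∀ q ∈ S, m q = m' q) :
    eval interp m α e = eval interp m' α e := by
  induction e generalizing S with
  | var x => rfl
  | app f es ih =>
    rw [scope] at hS
    split at hS
    case isFalse => simp at hS
    case isTrue h =>
      obtain rfl := Option.some.inj hS
      have key i : eval interp m α (es i) = eval interp m' α (es i) :=
        ih i (Option.some_get (h i)).symm fun q hq => hm q (Set.mem_iUnion.2 ⟨i, hq⟩)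
      simp only [eval, key]
  | read e ih =>
    rw [scope] at hS
    split at hS
    case h_2 => simp at hS
    case h_1 q T he hT =>
      obtain rfl := Option.some.inj hS
      have key := ih hT fun r hr => hm r (Or.inl hr)
      simp only [eval, ← key, he]
      exact hm q (Or.inr rfl)
  | cond e₀ e₁ e₂ ih₀ ih₁ ih₂ =>
    rw [scope] at hS
    split at hS
    case h_3 => simp at hS
    all_goals
      rename_i he
      split at hS
      case h_2 => simp at hS
      case h_1 S₀ S₁ h₀ h₁ =>
        obtain rfl := Option.some.inj hS
        have key := ih₀ h₀ fun r hr => hm r (Or.inl hr)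
        simp only [eval, ← key, he]
        first
          | exact ih₁ h₁ fun r hr => hm r (Or.inr hr)
          | exact ih₂ h₁ fun r hr => hm r (Or.inr hr)

end ScopeLogic

open ScopeLogic

theorem formula_scope_agreement {Ptr Var F : Type} {ar : F → ℕ}
    (interp : (f : F) → (Fin (ar f) → Val Ptr) → Option (Val Ptr))
    (p : Formula Var F ar) (m m' : Ptr → Option (Val Ptr))
    (h : ∀ e ∈ TopTerms p, ∀ α' : Var → Val Ptr, ∃ S : Set Ptr,
        scope interp m α' e = some S ∧ ∀ q ∈ S, m q = m' q) :
    ∀ α : Var → Val Ptr, feval interp m α p = feval interp m' α p := by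
  have eval_eq {e : Term Var F ar} {α : Var → Val Ptr}
      (he : ∃ S : Set Ptr, scope interp m α e = some S ∧ ∀ q ∈ S, m q = m' q) :
      eval interp m α e = eval interp m' α e :=
    he.elim fun _ hS => eval_eq_of_scope_agree interp m m' α e hS.1 hS.2
  induction p with
  | eq e₁ e₂ =>
    intro α
    simp only [feval, eval_eq (h e₁ (Or.inl rfl) α), eval_eq (h e₂ (Or.inr rfl) α)]
  | atom e =>
    intro α
    simp only [feval, eval_eq (h e rfl α)]
  | not p ih =>
    intro α
    simp only [feval, ih h α]
  | and p q ihp ihq =>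
    intro α
    simp only [feval, ihp (fun e he => h e (Or.inl he)) α, ihq (fun e he => h e (Or.inr he)) α]
  | delta p ih =>
    intro α
    simp only [feval, ih h α]
  | all x p ih =>
    intro α
    rw [feval, feval]
    congr! 4 <;> exact ih h _
end

section
/- (Soundness of the assignment rule, term part) Let e₁, e₂ be terms, α an assignment, and m a memory, and suppose ⟦e₁⟧_{m,α} = some a with a a pointer, ⟦𝔐(e₁)⟧_{m,α} = some S₁ with a ∉ S₁, and ⟦e₂⟧_{m,α} = some w. Let m' be the memory with m' a = some w and m' q = m q for all q ≠ a. Then: (i) ⟦∗e₁⟧_{m',α} = some w; and (ii) for every term e and every assignment α' such that ⟦𝔐(e)⟧_{m,α'} = some S with a ∉ S, ⟦e⟧_{m',α'} = ⟦e⟧_{m,α'}. -/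
open ScopeLogic

/-- The value of a term depends only on the memory units in its scope. -/
theorem ScopeLogic.eval_eq_of_eqOn_scope {Ptr Var F : Type} {ar : F → ℕ}
    (interp : (f : F) → (Fin (ar f) → Val Ptr) → Option (Val Ptr))
    {m m' : Ptr → Option (Val Ptr)} (α : Var → Val Ptr) (e : Term Var F ar) {S : Set Ptr}
    (hS : scope interp m α e = some S) (hm : Set.EqOn m' m S) :
    eval interp m' α e = eval interp m α e := by
  induction e generalizing S with
  | var x => rfl
  | app f es ih =>
    simp only [scope] at hS
    split at hS
    case isFalse => cases hS
    case isTrue h =>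
      cases hS
      have key : ∀ i, eval interp m' α (es i) = eval interp m α (es i) := fun i =>
        ih i (Option.some_get (h i)).symm (hm.mono (Set.subset_iUnion_of_subset i subset_rfl))
      simp only [eval, key]
  | read e ih =>
    simp only [scope] at hS
    split at hS
    case h_2 => cases hS
    case h_1 q T he hT =>
      cases hS
      have key := ih hT (hm.mono Set.subset_union_left)
      simp only [eval, key, he]
      exact hm (Or.inr rfl)
  | cond e₀ e₁ e₂ ih₀ ih₁ ih₂ =>
    simp only [scope] at hS
    split at hS
    case h_3 => cases hS
    case h_1 he₀ =>
      split at hS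
      case h_2 => cases hS
      case h_1 h₀ h₁ =>
        cases hS
        simp only [eval, ih₀ h₀ (hm.mono Set.subset_union_left), he₀,
          ih₁ h₁ (hm.mono Set.subset_union_right)]
    case h_2 he₀ =>
      split at hS
      case h_2 => cases hS
      case h_1 h₀ h₂ =>
        cases hS
        simp only [eval, ih₀ h₀ (hm.mono Set.subset_union_left), he₀,
          ih₂ h₂ (hm.mono Set.subset_union_right)]

theorem assignment_rule_sound_terms {Ptr Var F : Type} {ar : F → ℕ}
    (interp : (f : F) → (Fin (ar f) → Val Ptr) → Option (Val Ptr))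
    (e₁ e₂ : Term Var F ar) (α : Var → Val Ptr)
    (m : Ptr → Option (Val Ptr)) (a : Ptr) (S₁ : Set Ptr) (w : Val Ptr)
    (h₁ : eval interp m α e₁ = some (Val.ptr a))
    (hS₁ : scope interp m α e₁ = some S₁) (ha : a ∉ S₁)
    (h₂ : eval interp m α e₂ = some w)
    (m' : Ptr → Option (Val Ptr))
    (hm'a : m' a = some w) (hm' : ∀ q : Ptr, q ≠ a → m' q = m q) :
    eval interp m' α (Term.read e₁) = some w ∧
    ∀ (e : Term Var F ar) (α' : Var → Val Ptr) (S : Set Ptr),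
      scope interp m α' e = some S → a ∉ S →
      eval interp m' α' e = eval interp m α' e := by
  have agree : ∀ (e : Term Var F ar) (α' : Var → Val Ptr) (S : Set Ptr),
      scope interp m α' e = some S → a ∉ S →
      eval interp m' α' e = eval interp m α' e := fun e α' S hS haS =>
    eval_eq_of_eqOn_scope interp α' e hS fun q hq => hm' q (ne_of_mem_of_not_mem hq haS)
  refine ⟨?_, agree⟩
  simp only [eval, agree e₁ α S₁ hS₁ ha, h₁, Val.ptr, hm'a]
end

section
/- (Soundness of the assignment rule, formula part) Let m be a memory, a a pointer, w a value, and m' the memory with m' a = some w and m' q = m q for all q ≠ a. If p is a formula such that for every top-level term e of p and every assignment α', ⟦𝔐(e)⟧_{m,α'} = some S_{e,α'} with a ∉ S_{e,α'}, then ⟦p⟧_{m,α} = ⟦p⟧_{m',α} for every assignment α. -/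
namespace ScopeLogic

/-- Evaluating a term is unaffected by changing the memory outside its scope. -/
theorem eval_congr_of_notMem_scope {Ptr Var F : Type} {ar : F → ℕ}
    {interp : (f : F) → (Fin (ar f) → Val Ptr) → Option (Val Ptr)}
    {m m' : Ptr → Option (Val Ptr)} {a : Ptr}
    (hm : ∀ q : Ptr, q ≠ a → m' q = m q) {α : Var → Val Ptr} (e : Term Var F ar)
    {S : Set Ptr} (hS : scope interp m α e = some S) (ha : a ∉ S) :
    eval interp m' α e = eval interp m α e := by
  induction e generalizing S with
  | var x => rfl
  | app f es ih =>
    have hes : ∀ i, eval interp m' α (es i) = eval interp m α (es i) := by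
      rw [scope] at hS
      split at hS
      · next h =>
        obtain rfl := Option.some.inj hS
        exact fun i => ih i (Option.some_get (h i)).symm
          fun hi => ha (Set.mem_iUnion.2 ⟨i, hi⟩)
      · cases hS
    simp only [eval, hes]
  | read e ih =>
    rw [scope] at hS
    split at hS
    · next q T hq hT =>
      obtain rfl := Option.some.inj hS
      simp only [Set.mem_union, Set.mem_singleton_iff, not_or] at ha
      simp only [eval, ih hT ha.1, hq, hm q (Ne.symm ha.2)]
    · cases hS
  | cond e₀ e₁ e₂ ih₀ ih₁ ih₂ =>
    rw [scope] at hS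
    split at hS
    · next h₀ =>
      split at hS
      · next S₀ S₁ hS₀ hS₁ =>
        obtain rfl := Option.some.inj hS
        simp only [Set.mem_union, not_or] at ha
        simp only [eval, ih₀ hS₀ ha.1, h₀, ih₁ hS₁ ha.2]
      · cases hS
    · next h₀ =>
      split at hS
      · next S₀ S₂ hS₀ hS₂ =>
        obtain rfl := Option.some.inj hS
        simp only [Set.mem_union, not_or] at ha
        simp only [eval, ih₀ hS₀ ha.1, h₀, ih₂ hS₂ ha.2]
      · cases hS
    · cases hS

/-- The truth value of a formula depends on the memory only through its top-level terms. -/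
theorem feval_congr {Ptr Var F : Type} {ar : F → ℕ}
    {interp : (f : F) → (Fin (ar f) → Val Ptr) → Option (Val Ptr)}
    {m m' : Ptr → Option (Val Ptr)} (p : Formula Var F ar)
    (h : ∀ e ∈ TopTerms p, ∀ α : Var → Val Ptr, eval interp m α e = eval interp m' α e)
    (α : Var → Val Ptr) : feval interp m α p = feval interp m' α p := by
  induction p generalizing α with
  | eq e₁ e₂ => simp only [feval, h e₁ (Or.inl rfl), h e₂ (Or.inr rfl)]
  | atom e => simp only [feval, h e rfl]
  | not p ih => simp only [feval, ih h]
  | and p q ihp ihq =>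
    simp only [feval, ihp fun e he => h e (Or.inl he), ihq fun e he => h e (Or.inr he)]
  | delta p ih => simp only [feval, ih h]
  | all x p ih =>
    unfold feval
    congr! 4 <;> exact ih h _

end ScopeLogic

open ScopeLogic

theorem assignment_rule_sound_formulas {Ptr Var F : Type} {ar : F → ℕ}
    (interp : (f : F) → (Fin (ar f) → Val Ptr) → Option (Val Ptr))
    (m : Ptr → Option (Val Ptr)) (a : Ptr) (w : Val Ptr)
    (m' : Ptr → Option (Val Ptr))
    (hm'a : m' a = some w) (hm' : ∀ q : Ptr, q ≠ a → m' q = m q)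
    (p : Formula Var F ar)
    (h : ∀ e ∈ TopTerms p, ∀ α' : Var → Val Ptr, ∃ S : Set Ptr,
        scope interp m α' e = some S ∧ a ∉ S) :
    ∀ α : Var → Val Ptr, feval interp m α p = feval interp m' α p := by
  refine feval_congr p fun e he α => ?_
  obtain ⟨S, hS, ha⟩ := h e he α
  exact (eval_congr_of_notMem_scope hm' e hS ha).symm
end

section
/- If isBST t holds and p is a node position of t with key(t,p) = K_p and data(t,p) = D_p, then Map t = MapP t p † {K_p ↦ D_p} (as functions ℤ → Option ℤ). -/
namespace ScopeLogicBST

/-- Binary trees whose nodes carry an integer key and integer data. -/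
inductive T : Type where
  | leaf : T
  | node : T → T → ℤ → ℤ → T

/-- The key set of a tree. -/
def Dom : T → Finset ℤ
  | .leaf => ∅
  | .node l r K _ => {K} ∪ Dom l ∪ Dom r

/-- The finite map defined only at `K`, with value `D`. -/
def single (K D : ℤ) : ℤ → Option ℤ := fun k => if k = K then some D else none

/-- Right-biased override of finite maps. -/
def ovr (M M' : ℤ → Option ℤ) : ℤ → Option ℤ := fun k =>
  match M' k with
  | some v => some v
  | none => M k

infixl:65 " † " => ovr

/-- The finite map retrieved from a tree. -/
def Map : T → ℤ → Option ℤ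
  | .leaf => fun _ => none
  | .node l r K D => (single K D † Map l) † Map r

/-- Binary-search-tree property. -/
def isBST : T → Prop
  | .leaf => True
  | .node l r K _ =>
      isBST l ∧ isBST r ∧ (∀ k ∈ Dom l, k < K) ∧ (∀ k ∈ Dom r, K < k)

end ScopeLogicBST

namespace ScopeLogicBST

/-- Directions into a binary tree. -/
inductive Dir : Type where
  | L : Dir
  | R : Dir

/-- The subtree of a tree at a given position, if any. -/
def subtree : T → List Dir → Option T
  | t, [] => some t
  | .leaf, _ :: _ => none
  | .node l _ _ _, .L :: p => subtree l p
  | .node _ r _ _, .R :: p => subtree r p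

end ScopeLogicBST

namespace ScopeLogicBST

/-- The map of `t` with the single entry contributed by the node at position `p` omitted. -/
def MapP : T → List Dir → ℤ → Option ℤ
  | .leaf, _ => fun _ => none
  | .node l r _ _, [] => Map l † Map r
  | .node l r K D, .L :: p => (single K D † MapP l p) † Map r
  | .node l r K D, .R :: p => (single K D † Map l) † MapP r p

end ScopeLogicBST

namespace ScopeLogicBST

theorem ovr_assoc (A B C : ℤ → Option ℤ) : A † B † C = A † (B † C) := by
  funext k
  simp only [ovr]
  cases C k <;> rfl

/-- Overriding by a singleton commutes with overriding by a map undefined at its key. -/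
theorem ovr_single_comm {M : ℤ → Option ℤ} {K : ℤ} (D : ℤ) (h : M K = none) :
    single K D † M = M † single K D := by
  funext k
  by_cases hk : k = K
  · subst hk
    simp [ovr, single, h]
  · simp only [ovr, single, if_neg hk]
    cases M k <;> rfl

theorem map_eq_none_of_notMem_dom {t : T} {k : ℤ} (h : k ∉ Dom t) : Map t k = none := by
  induction t with
  | leaf => rfl
  | node l r K D ihl ihr =>
    simp only [Dom, Finset.mem_union, Finset.mem_singleton, not_or] at h
    simp [Map, ovr, single, ihl h.1.2, ihr h.2, h.1.1]

theorem key_mem_dom_of_subtree {t l' r' : T} {p : List Dir} {K D : ℤ}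
    (h : subtree t p = some (T.node l' r' K D)) : K ∈ Dom t := by
  induction p generalizing t with
  | nil =>
    cases t <;> simp_all [subtree, Dom]
  | cons d p ih =>
    cases t with
    | leaf => simp [subtree] at h
    | node l r K₀ D₀ =>
      cases d with
      | L => simp [Dom, ih (t := l) h]
      | R => simp [Dom, ih (t := r) h]

end ScopeLogicBST

open ScopeLogicBST

theorem map_eq_mapP_override (t : T) (p : List Dir) (l' r' : T) (Kp Dp : ℤ)
    (hbst : isBST t) (hp : subtree t p = some (T.node l' r' Kp Dp)) :
    Map t = MapP t p † single Kp Dp := by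
  induction p generalizing t with
  | nil =>
    cases t with
    | leaf => simp [subtree] at hp
    | node l r K D =>
      simp only [subtree, Option.some.injEq, T.node.injEq] at hp
      obtain ⟨rfl, rfl, rfl, rfl⟩ := hp
      obtain ⟨-, -, hl, hr⟩ := hbst
      have hlK := map_eq_none_of_notMem_dom fun h => lt_irrefl _ (hl _ h)
      have hrK := map_eq_none_of_notMem_dom fun h => lt_irrefl _ (hr _ h)
      rw [Map, MapP, ovr_single_comm _ hlK, ovr_assoc, ovr_single_comm _ hrK, ← ovr_assoc]
  | cons d p ih =>
    cases t with
    | leaf => simp [subtree] at hp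
    | node l r K D =>
      obtain ⟨hbl, hbr, hl, hr⟩ := hbst
      cases d with
      | L =>
        have hlt := hl _ (key_mem_dom_of_subtree (t := l) hp)
        have hrKp := map_eq_none_of_notMem_dom fun h => lt_asymm hlt (hr _ h)
        rw [Map, MapP, ih l hbl hp, ← ovr_assoc, ovr_assoc _ (single Kp Dp),
          ovr_single_comm _ hrKp, ← ovr_assoc]
      | R => rw [Map, MapP, ih r hbr hp, ← ovr_assoc]
end

section
/- (Invariant preservation of the insertion loop) Suppose isBST t holds, insertableAt t p k holds, and subtree t p = some (node l r K D). If k < K then insertableAt t (p ++ [L]) k holds, and if K < k then insertableAt t (p ++ [R]) k holds. -/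
namespace ScopeLogicBST

infixl:65 " † " => ovr

end ScopeLogicBST

namespace ScopeLogicBST

/-- The tree obtained from `t` by replacing the subtree at position `p` with `s`
(`none` when the position does not exist). -/
def replace : T → List Dir → T → Option T
  | _, [], s => some s
  | .leaf, _ :: _, _ => none
  | .node l r K D, .L :: p, s => (replace l p s).map (fun l' => T.node l' r K D)
  | .node l r K D, .R :: p, s => (replace r p s).map (fun r' => T.node l r' K D)

/-- The position `p` exists in `t` and replacing the subtree there by a fresh node
carrying key `k` (and arbitrary data) always yields a binary search tree. -/
def insertableAt (t : T) (p : List Dir) (k : ℤ) : Prop :=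
  (subtree t p).isSome ∧
    ∀ d : ℤ, ∃ t', replace t p (T.node .leaf .leaf k d) = some t' ∧ isBST t'

end ScopeLogicBST

namespace ScopeLogicBST

theorem subtree_append (t : T) (p q : List Dir) :
    subtree t (p ++ q) = (subtree t p).bind (fun u => subtree u q) := by
  induction p generalizing t with
  | nil => simp [subtree]
  | cons d p ih => cases t <;> cases d <;> simp [subtree, ih]

theorem replace_append {t u u' s : T} {p q : List Dir} (hp : subtree t p = some u)
    (hu : replace u q s = some u') : replace t (p ++ q) s = replace t p u' := by
  induction p generalizing t with
  | nil =>
    obtain rfl : t = u := by simpa [subtree] using hp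
    simpa [replace] using hu
  | cons d p ih =>
    cases t <;> cases d <;> simp only [subtree, reduceCtorEq] at hp <;>
      simp [replace, ih hp]

theorem isBST_of_subtree {t u : T} {p : List Dir} (ht : isBST t)
    (hp : subtree t p = some u) : isBST u := by
  induction p generalizing t with
  | nil =>
    obtain rfl : t = u := by simpa [subtree] using hp
    exact ht
  | cons d p ih =>
    cases t <;> cases d <;> simp only [subtree, reduceCtorEq] at hp
    · exact ih ht.1 hp
    · exact ih ht.2.1 hp

/-- If `t` and the tree obtained by putting `a` at position `p` are both search trees, then any
search tree whose keys come from `a` and from the subtree at `p` can be put there as well. -/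
theorem exists_replace_isBST {t u a b ta : T} {p : List Dir} (ht : isBST t)
    (hp : subtree t p = some u) (ha : replace t p a = some ta) (hta : isBST ta)
    (hb : isBST b) (hdom : Dom b ⊆ Dom a ∪ Dom u) :
    ∃ tb, replace t p b = some tb ∧ isBST tb ∧ Dom tb ⊆ Dom ta ∪ Dom t := by
  induction p generalizing t ta with
  | nil =>
    obtain rfl : t = u := by simpa [subtree] using hp
    obtain rfl : a = ta := by simpa [replace] using ha
    exact ⟨b, by simp [replace], hb, hdom⟩
  | cons d p ih =>
    cases t with
    | leaf => simp [subtree] at hp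
    | node l r K D =>
      obtain ⟨hl, hr, hlK, hKr⟩ := ht
      cases d with
      | L =>
        obtain ⟨la, hla, rfl⟩ := Option.map_eq_some_iff.1 ha
        obtain ⟨hbla, _, hlaK, _⟩ := hta
        obtain ⟨lb, hlb, hblb, hsub⟩ := ih hl hp hla hbla
        refine ⟨.node lb r K D, by simp [replace, hlb], ⟨hblb, hr, fun x hx => ?_, hKr⟩, ?_⟩
        · exact (Finset.mem_union.1 (hsub hx)).elim (hlaK x) (hlK x)
        · intro x hx
          have := @hsub x
          simp only [Dom, Finset.mem_union, Finset.mem_singleton] at *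
          tauto
      | R =>
        obtain ⟨ra, hra, rfl⟩ := Option.map_eq_some_iff.1 ha
        obtain ⟨_, hbra, _, hKra⟩ := hta
        obtain ⟨rb, hrb, hbrb, hsub⟩ := ih hr hp hra hbra
        refine ⟨.node l rb K D, by simp [replace, hrb], ⟨hl, hbrb, hlK, fun x hx => ?_⟩, ?_⟩
        · exact (Finset.mem_union.1 (hsub hx)).elim (hKra x) (hKr x)
        · intro x hx
          have := @hsub x
          simp only [Dom, Finset.mem_union, Finset.mem_singleton] at *
          tauto

end ScopeLogicBST

open ScopeLogicBST

theorem insertableAt_step (t : T) (p : List Dir) (k : ℤ) (l r : T) (K D : ℤ)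
    (hbst : isBST t) (hins : insertableAt t p k)
    (hp : subtree t p = some (T.node l r K D)) :
    (k < K → insertableAt t (p ++ [Dir.L]) k) ∧
    (K < k → insertableAt t (p ++ [Dir.R]) k) := by
  obtain ⟨hl, hr, hlK, hKr⟩ := isBST_of_subtree hbst hp
  constructor
  · refine fun hk => ⟨by simp [subtree_append, hp, subtree], fun d => ?_⟩
    obtain ⟨ta, hta, hbta⟩ := hins.2 d
    obtain ⟨tb, htb, hbtb, _⟩ := exists_replace_isBST
      (b := .node (.node .leaf .leaf k d) r K D) hbst hp hta hbta
      ⟨by simp [isBST, Dom], hr, by simpa [Dom] using hk, hKr⟩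
      (by intro x; simp only [Dom, Finset.mem_union, Finset.mem_singleton]; tauto)
    exact ⟨tb, (replace_append hp (by simp [replace])).trans htb, hbtb⟩
  · refine fun hk => ⟨by simp [subtree_append, hp, subtree], fun d => ?_⟩
    obtain ⟨ta, hta, hbta⟩ := hins.2 d
    obtain ⟨tb, htb, hbtb, _⟩ := exists_replace_isBST
      (b := .node l (.node .leaf .leaf k d) K D) hbst hp hta hbta
      ⟨hl, by simp [isBST, Dom], hlK, by simpa [Dom] using hk⟩
      (by intro x; simp only [Dom, Finset.mem_union, Finset.mem_singleton]; tauto)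
    exact ⟨tb, (replace_append hp (by simp [replace])).trans htb, hbtb⟩
end
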